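/- arXiv:2008.00690 — 2 statements merged into one kernel-verified Lean document; each statement's English description precedes it below -/
import Mathlib

section
/- Let 0 < τ < 1 and define Ψ : [1+τ, ∞) → ℝ by Ψ(x) = −1/2 + x²/(2(1+τ)) − (1/(8τ))·(x − √(x² − 4τ))² − log((x + √(x² − 4τ))/2). Then Ψ(1+τ) = 0 and Ψ is strictly increasing on [1+τ, ∞). -/
open Real MeasureTheory Filter

/-- The large deviation rate function for the right tail of `x_max` in the real
elliptic ensemble. -/
noncomputable def PsiR (τ x : ℝ) : ℝ :=
  -1/2 + x^2 / (2*(1+τ)) - (1/(8*τ)) * (x - Real.sqrt (x^2 - 4*τ))^2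
    - Real.log ((x + Real.sqrt (x^2 - 4*τ)) / 2)

/-- Above the spectral edge the discriminant root exceeds its edge value `1 - τ`. -/
theorem one_sub_le_sqrt_sq_sub {τ x : ℝ} (hτ0 : 0 < τ) (hx : 1 + τ ≤ x) :
    1 - τ ≤ √(x ^ 2 - 4 * τ) := by
  apply Real.le_sqrt_of_sq_le
  nlinarith

theorem hasDerivAt_PsiR {τ x : ℝ} (hτ0 : 0 < τ) (hτ1 : τ < 1) (hx : 1 + τ ≤ x) :
    HasDerivAt (PsiR τ) (x / (1 + τ) - 2 / (x + √(x ^ 2 - 4 * τ))) x := by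
  have hx0 : 0 < x := by linarith
  have hD : 0 < x ^ 2 - 4 * τ := by nlinarith [sq_pos_of_pos (sub_pos.2 hτ1)]
  have hs : 0 < √(x ^ 2 - 4 * τ) := Real.sqrt_pos.2 hD
  have hsq : √(x ^ 2 - 4 * τ) ^ 2 = x ^ 2 - 4 * τ := Real.sq_sqrt hD.le
  have hid : HasDerivAt (fun y : ℝ => y) 1 x := hasDerivAt_id' x
  have hpow : HasDerivAt (fun y : ℝ => y ^ 2) (2 * x) x := by
    simpa using hasDerivAt_pow 2 x
  have hroot : HasDerivAt (fun y : ℝ => √(y ^ 2 - 4 * τ))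
      (x / √(x ^ 2 - 4 * τ)) x :=
    ((hpow.sub_const (4 * τ)).sqrt hD.ne').congr_deriv (mul_div_mul_left _ _ two_ne_zero)
  have hlog := ((hid.fun_add hroot).div_const 2).log (by positivity)
  have hmain := (((hpow.div_const (2 * (1 + τ))).const_add (-1 / 2)).fun_sub
    (((hid.fun_sub hroot).fun_pow 2).const_mul (1 / (8 * τ)))).fun_sub hlog
  refine hmain.congr_deriv ?_
  simp only [Nat.cast_ofNat, Nat.add_one_sub_one, pow_one]
  generalize √(x ^ 2 - 4 * τ) = s at hs hsq
  have hxs : 0 < x + s := by linarith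
  have hτ : τ = (x - s) * (x + s) / 4 := by linarith
  have hτ' : 1 / (8 * τ) * (2 * (x - s) * (1 - x / s)) = -((x - s) / (s * (x + s))) := by
    have hd : 0 < x - s := by
      by_contra! h
      nlinarith
    rw [hτ]
    field_simp
    ring
  have hlin : 2 * x / (2 * (1 + τ)) = x / (1 + τ) := mul_div_mul_left _ _ two_ne_zero
  rw [hτ', hlin]
  field_simp
  ring

/-- `Ψ^{(r)}` vanishes at the spectral edge `x = 1+τ` and is strictly increasing on
`[1+τ, ∞)`. -/
theorem psiR_zero_at_edge_and_strictMono
    (τ : ℝ) (hτ0 : 0 < τ) (hτ1 : τ < 1) :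
    PsiR τ (1+τ) = 0 ∧ StrictMonoOn (PsiR τ) (Set.Ici (1+τ)) := by
  constructor
  · have hroot : √((1 + τ) ^ 2 - 4 * τ) = 1 - τ := by
      rw [show (1 + τ) ^ 2 - 4 * τ = (1 - τ) ^ 2 by ring, Real.sqrt_sq (by linarith)]
    have hone : (1 + τ + (1 - τ)) / 2 = 1 := by ring
    rw [PsiR, hroot, hone, Real.log_one]
    field_simp
    ring
  · refine strictMonoOn_of_deriv_pos (convex_Ici _)
      (fun x hx => (hasDerivAt_PsiR hτ0 hτ1 hx).continuousAt.continuousWithinAt) fun x hx => ?_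
    rw [interior_Ici, Set.mem_Ioi] at hx
    rw [(hasDerivAt_PsiR hτ0 hτ1 hx.le).deriv, sub_pos]
    have hs := one_sub_le_sqrt_sq_sub hτ0 hx.le
    have hsum : 2 < x + √(x ^ 2 - 4 * τ) := by linarith
    calc 2 / (x + √(x ^ 2 - 4 * τ)) < 1 := (div_lt_one (by linarith)).2 hsum
      _ < x / (1 + τ) := (one_lt_div (by linarith)).2 hx
end

section
/- For a ≥ 0 and integer N ≥ 2 let G(N−1, a) = ∫_a^∞ e^{−t} t^{N−2} dt denote the upper incomplete gamma function. Then for every fixed real α, lim_{N→∞} G(N−1, N·(1 + α·N^{−1/2}))/Γ(N−1) = (1/√(2π)) · ∫_α^∞ e^{−v²/2} dv, where the limit is over natural numbers N → ∞ (with N large enough that 1 + α N^{−1/2} ≥ 0). -/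
open Real MeasureTheory Filter

/-- The upper incomplete gamma function `G(N−1, a) = ∫_a^∞ e^{−t} t^{N−2} dt`,
so that `G(N−1, 0) = Γ(N−1)` for `N ≥ 2`. -/
noncomputable def incGamma (N : ℕ) (a : ℝ) : ℝ :=
  ∫ t in Set.Ioi a, Real.exp (-t) * t ^ (N - 2)

/-- The Gamma integrand `e^{-t} t^m`, recentred at `t = m`, rescaled by `√m` and normalised to
have value `1` at its maximum `v = 0`. -/
noncomputable def rescaledGammaDensity (m : ℕ) (v : ℝ) : ℝ :=
  Real.exp (-(√m * v)) * (1 + v / √m) ^ m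

lemma continuous_rescaledGammaDensity (m : ℕ) : Continuous (rescaledGammaDensity m) := by
  unfold rescaledGammaDensity
  fun_prop

lemma setIntegral_Ioi_eq_mul_setIntegral_Ioi (g : ℝ → ℝ) (a b : ℝ) {s : ℝ} (hs : 0 < s) :
    ∫ t in Set.Ioi a, g t = s * ∫ v in Set.Ioi ((a - b) / s), g (b + s * v) := by
  have h := integral_comp_mul_left_Ioi (fun t ↦ g (b + t)) ((a - b) / s) hs
  rw [h, mul_div_cancel₀ _ hs.ne', smul_eq_mul, mul_inv_cancel_left₀ hs.ne',
    ← integral_indicator measurableSet_Ioi, ← integral_indicator measurableSet_Ioi,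
    ← integral_add_left_eq_self _ b]
  congr 1 with t
  simp only [Set.indicator_apply, Set.mem_Ioi, sub_lt_iff_lt_add']

lemma incGamma_add_two_eq {m : ℕ} (hm : 0 < m) (a : ℝ) :
    incGamma (m + 2) a = √m * (Real.exp (-m) * (m : ℝ) ^ m) *
      ∫ v in Set.Ioi ((a - m) / √m), rescaledGammaDensity m v := by
  have hm' : (0 : ℝ) < m := by exact_mod_cast hm
  have hs : 0 < √(m : ℝ) := Real.sqrt_pos.2 hm'
  rw [incGamma, setIntegral_Ioi_eq_mul_setIntegral_Ioi _ a m hs, mul_assoc,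
    ← integral_const_mul (Real.exp (-m) * (m : ℝ) ^ m)]
  congr 1
  refine integral_congr_ae (.of_forall fun v ↦ ?_)
  beta_reduce
  have h : (m : ℝ) + √m * v = m * (1 + v / √m) := by
    have := Real.mul_self_sqrt hm'.le
    field_simp
    linear_combination v * this
  rw [rescaledGammaDensity, Nat.add_sub_cancel, neg_add, Real.exp_add, h, mul_pow]
  ring

lemma rescaledGammaDensity_eq_exp {m : ℕ} {v : ℝ} (hm : 0 < m) (hv : -√m < v) :
    rescaledGammaDensity m v = Real.exp (√m ^ 2 * Real.log (1 + v / √m) - √m * v) := by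
  have hs : 0 < √(m : ℝ) := Real.sqrt_pos.2 (by exact_mod_cast hm)
  have hy : 0 < 1 + v / √(m : ℝ) := by
    have : 1 + v / √(m : ℝ) = (√m + v) / √m := by field_simp
    rw [this]
    exact div_pos (by linarith) hs
  rw [Real.sq_sqrt (by positivity), sub_eq_neg_add, Real.exp_add, Real.exp_nat_mul,
    Real.exp_log hy, rescaledGammaDensity]

lemma sq_mul_log_one_add_div_sub_le {s v : ℝ} (hs : 1 ≤ s) (hv : -s < v) :
    s ^ 2 * Real.log (1 + v / s) - s * v ≤ (1 - |v|) / 2 := by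
  have hs0 : 0 < s := by linarith
  rcases le_or_gt 0 v with h | h
  · have hy : 1 ≤ 1 + v / s := by
      have := div_nonneg h hs0.le
      linarith
    have hlog := Real.self_le_sinh_iff.2 (Real.log_nonneg hy)
    rw [Real.sinh_log (by linarith)] at hlog
    have hsv : 0 < s + v := by linarith
    have key : s ^ 2 * ((1 + v / s - (1 + v / s)⁻¹) / 2) - s * v
        = (1 - v) / 2 - ((s - 1) * (v ^ 2 - v + 1) + 1) / (2 * (s + v)) := by
      have : 1 + v / s = (s + v) / s := by field_simp
      rw [this]
      field_simp
      ring
    have hpos : 0 ≤ ((s - 1) * (v ^ 2 - v + 1) + 1) / (2 * (s + v)) := by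
      have : 0 ≤ v ^ 2 - v + 1 := by nlinarith [sq_nonneg (v - 1 / 2)]
      have := mul_nonneg (sub_nonneg.2 hs) this
      positivity
    have := mul_le_mul_of_nonneg_left hlog (sq_nonneg s)
    rw [abs_of_nonneg h]
    linarith
  · have hx0 : 0 < -v / s := div_pos (by linarith) hs0
    have hx1 : -v / s < 1 := (div_lt_one hs0).2 (by linarith)
    have hsum := sum_le_hasSum (Finset.range 2) (fun i _ ↦ by positivity)
      (Real.hasSum_pow_div_log_of_abs_lt_one (x := -v / s) (by rwa [abs_of_pos hx0]))
    have hlog : Real.log (1 + v / s) ≤ v / s - (v / s) ^ 2 / 2 := by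
      have : 1 - -v / s = 1 + v / s := by ring
      rw [this] at hsum
      norm_num [Finset.sum_range_succ] at hsum
      have e1 : -v / s = -(v / s) := by ring
      rw [e1, neg_sq] at hsum
      linarith
    have := mul_le_mul_of_nonneg_left hlog (sq_nonneg s)
    have key : s ^ 2 * (v / s - (v / s) ^ 2 / 2) = s * v - v ^ 2 / 2 := by
      field_simp
    rw [abs_of_neg h]
    nlinarith [sq_nonneg (v + 1 / 2)]

lemma tendsto_sq_mul_log_one_add_div_sub (v : ℝ) :
    Tendsto (fun s : ℝ ↦ s ^ 2 * Real.log (1 + v / s) - s * v) atTop (nhds (-v ^ 2 / 2)) := by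
  rw [tendsto_iff_norm_sub_tendsto_zero]
  have hv : Tendsto (fun s : ℝ ↦ |v| / s) atTop (nhds 0) := tendsto_const_nhds.div_atTop tendsto_id
  have hlim : Tendsto (fun s : ℝ ↦ |v| ^ 2 * (|v| / s) / (1 - |v| / s)) atTop (nhds 0) := by
    have := (hv.const_mul (|v| ^ 2)).div (hv.const_sub 1) (by simp)
    rwa [mul_zero, zero_div] at this
  refine squeeze_zero' (.of_forall fun _ ↦ norm_nonneg _) ?_ hlim
  filter_upwards [eventually_gt_atTop |v|] with s hs
  have hs0 : 0 < s := (abs_nonneg v).trans_lt hs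
  have habs : |(-v / s)| = |v| / s := by rw [abs_div, abs_neg, abs_of_pos hs0]
  have h := Real.abs_log_sub_add_sum_range_le (x := -v / s)
    (by rwa [habs, div_lt_one hs0]) 2
  rw [habs] at h
  have h2 := mul_le_mul_of_nonneg_left h (sq_nonneg s)
  rw [← abs_of_nonneg (sq_nonneg s), ← abs_mul, abs_of_nonneg (sq_nonneg s)] at h2
  rw [Real.norm_eq_abs]
  convert! h2 using 1
  · congr 1
    have : 1 - -v / s = 1 + v / s := by ring
    rw [this]
    norm_num [Finset.sum_range_succ]
    field_simp
    ring
  · rw [div_pow]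
    field_simp
    ring

lemma integrable_exp_one_sub_abs_div_two :
    Integrable (fun v : ℝ ↦ Real.exp ((1 - |v|) / 2)) := by
  have h : Integrable (fun v : ℝ ↦ Real.exp (-(1 / 2) * |v|)) := by
    rw [← integrableOn_univ, ← Set.Iic_union_Ioi (a := (0 : ℝ))]
    refine IntegrableOn.union ?_ ?_
    · refine (integrableOn_exp_mul_Iic (a := 1 / 2) (by norm_num) 0).congr_fun
        (fun v hv ↦ ?_) measurableSet_Iic
      simp only [abs_of_nonpos (Set.mem_Iic.1 hv), neg_mul_neg]
    · refine (integrableOn_exp_mul_Ioi (a := -(1 / 2)) (by norm_num) 0).congr_fun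
        (fun v hv ↦ ?_) measurableSet_Ioi
      simp only [abs_of_pos (Set.mem_Ioi.1 hv)]
  refine (h.const_mul (Real.exp (1 / 2))).congr (.of_forall fun v ↦ ?_)
  simp only [← Real.exp_add]
  ring_nf

lemma tendsto_sqrt_natCast_atTop : Tendsto (fun m : ℕ ↦ √(m : ℝ)) atTop atTop :=
  Real.tendsto_sqrt_atTop.comp tendsto_natCast_atTop_atTop

/-- Laplace's method for the Gamma integral: if the half-lines `(c m, ∞)` converge a.e. to `S`,
then the integrals of the rescaled density converge to the Gaussian integral over `S`. -/
lemma tendsto_setIntegral_rescaledGammaDensity {c : ℕ → ℝ} {S : Set ℝ} (hS : MeasurableSet S)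
    (hc : ∀ᶠ m : ℕ in atTop, -√m ≤ c m)
    (hcS : ∀ᵐ v : ℝ, ∀ᶠ m : ℕ in atTop, (c m < v ↔ v ∈ S)) :
    Tendsto (fun m : ℕ ↦ ∫ v in Set.Ioi (c m), rescaledGammaDensity m v) atTop
      (nhds (∫ v in S, Real.exp (-v ^ 2 / 2))) := by
  simp_rw [← integral_indicator measurableSet_Ioi, ← integral_indicator hS]
  refine tendsto_integral_filter_of_dominated_convergence _ ?_ ?_
    integrable_exp_one_sub_abs_div_two ?_
  · exact .of_forall fun m ↦ ((continuous_rescaledGammaDensity m).measurable.indicator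
      measurableSet_Ioi).aestronglyMeasurable
  · filter_upwards [hc, eventually_gt_atTop 0] with m hcm hm
    refine .of_forall fun v ↦ ?_
    by_cases hv : v ∈ Set.Ioi (c m)
    · have hv' : -√m < v := hcm.trans_lt hv
      rw [Set.indicator_of_mem hv, rescaledGammaDensity_eq_exp hm hv',
        Real.norm_of_nonneg (Real.exp_pos _).le]
      exact Real.exp_le_exp.2 (sq_mul_log_one_add_div_sub_le
        (Real.one_le_sqrt.2 (by exact_mod_cast hm)) hv')
    · rw [Set.indicator_of_notMem hv, norm_zero]
      positivity
  · filter_upwards [hcS] with v hv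
    by_cases hvS : v ∈ S
    · rw [Set.indicator_of_mem hvS]
      refine (((Real.continuous_exp.tendsto _).comp (tendsto_sq_mul_log_one_add_div_sub v)).comp
        tendsto_sqrt_natCast_atTop).congr' ?_
      filter_upwards [hv, hc, eventually_gt_atTop 0] with m h hcm hm
      have hlt : c m < v := h.2 hvS
      rw [Set.indicator_of_mem (Set.mem_Ioi.2 hlt),
        rescaledGammaDensity_eq_exp hm (hcm.trans_lt hlt)]
      rfl
    · rw [Set.indicator_of_notMem hvS]
      refine tendsto_const_nhds.congr' ?_
      filter_upwards [hv] with m h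
      rw [Set.indicator_of_notMem (mt h.1 hvS : v ∉ Set.Ioi (c m))]

lemma tendsto_setIntegral_Ioi_rescaledGammaDensity {c : ℕ → ℝ} {α : ℝ}
    (hc : Tendsto c atTop (nhds α)) :
    Tendsto (fun m : ℕ ↦ ∫ v in Set.Ioi (c m), rescaledGammaDensity m v) atTop
      (nhds (∫ v in Set.Ioi α, Real.exp (-v ^ 2 / 2))) := by
  refine tendsto_setIntegral_rescaledGammaDensity measurableSet_Ioi ?_ ?_
  · filter_upwards [hc.eventually_const_lt (sub_one_lt α),
      tendsto_sqrt_natCast_atTop.eventually_ge_atTop (1 - α)] with m h₁ h₂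
    linarith
  · filter_upwards [Measure.ae_ne volume α] with v hv
    rcases hv.lt_or_gt with h | h
    · filter_upwards [hc.eventually_const_lt h] with m hm
      exact iff_of_false hm.not_gt (Set.notMem_Ioi.2 h.le)
    · filter_upwards [hc.eventually_lt_const h] with m hm
      exact iff_of_true hm h

lemma tendsto_setIntegral_Ioi_neg_sqrt_rescaledGammaDensity :
    Tendsto (fun m : ℕ ↦ ∫ v in Set.Ioi (-√m), rescaledGammaDensity m v) atTop
      (nhds √(2 * π)) := by
  have h := tendsto_setIntegral_rescaledGammaDensity (c := fun m ↦ -√m) MeasurableSet.univ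
    (.of_forall fun _ ↦ le_rfl) (.of_forall fun v ↦ by
      filter_upwards [tendsto_sqrt_natCast_atTop.eventually_gt_atTop (-v)] with m hm
      exact iff_of_true (by linarith) trivial)
  have hg : ∫ v : ℝ, Real.exp (-v ^ 2 / 2) = √(2 * π) := by
    have := integral_gaussian (1 / 2)
    rw [div_div_eq_mul_div, div_one, mul_comm π] at this
    rw [← this]
    congr 1 with v
    ring_nf
  rwa [setIntegral_univ, hg] at h

lemma tendsto_rescaled_threshold (α : ℝ) :
    Tendsto (fun m : ℕ ↦
      (((m + 2 : ℕ) : ℝ) * (1 + α * ((m + 2 : ℕ) : ℝ) ^ (-(1 : ℝ) / 2)) - m) / √m)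
      atTop (nhds α) := by
  have hinv : Tendsto (fun m : ℕ ↦ 2 / √(m : ℝ)) atTop (nhds 0) :=
    tendsto_const_nhds.div_atTop tendsto_sqrt_natCast_atTop
  have hinv' : Tendsto (fun m : ℕ ↦ 2 / (m : ℝ)) atTop (nhds 0) :=
    tendsto_const_nhds.div_atTop tendsto_natCast_atTop_atTop
  have hlim : Tendsto (fun m : ℕ ↦ 2 / √(m : ℝ) + α * √(1 + 2 / (m : ℝ))) atTop (nhds α) := by
    simpa using hinv.add (((hinv'.const_add 1).sqrt).const_mul α)
  refine hlim.congr' ?_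
  filter_upwards [eventually_gt_atTop 0] with m hm
  have hm' : (0 : ℝ) < m := by exact_mod_cast hm
  have hsq : (1 : ℝ) + 2 / m = ((m + 2 : ℕ) : ℝ) / m := by
    push_cast
    field_simp
  have hpow : ((m + 2 : ℕ) : ℝ) * ((m + 2 : ℕ) : ℝ) ^ (-(1 : ℝ) / 2) = √((m + 2 : ℕ) : ℝ) := by
    rw [Real.sqrt_eq_rpow, ← Real.rpow_one_add' (by positivity) (by norm_num)]
    norm_num
  rw [hsq, Real.sqrt_div' _ hm'.le, mul_add, mul_left_comm, hpow]
  push_cast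
  ring

/-- Transition-region limit of the incomplete gamma ratio:
`G(N−1, N(1+αN^{−1/2}))/Γ(N−1) → (1/√(2π)) ∫_α^∞ e^{−v²/2} dv`. -/
theorem incGamma_ratio_transition (α : ℝ) :
    Tendsto
      (fun N : ℕ =>
        incGamma N ((N : ℝ) * (1 + α * (N : ℝ) ^ (-(1:ℝ)/2))) / incGamma N 0)
      atTop
      (nhds ((1 / Real.sqrt (2 * Real.pi)) * ∫ v in Set.Ioi α, Real.exp (-v^2/2))) := by
  rw [← tendsto_add_atTop_iff_nat 2, one_div_mul_eq_div]
  have hπ : √(2 * π) ≠ 0 := by positivity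
  refine ((tendsto_setIntegral_Ioi_rescaledGammaDensity (tendsto_rescaled_threshold α)).div
    tendsto_setIntegral_Ioi_neg_sqrt_rescaledGammaDensity hπ).congr' ?_
  filter_upwards [eventually_gt_atTop 0] with m hm
  have hm' : (0 : ℝ) < m := by exact_mod_cast hm
  have h0 : (0 - (m : ℝ)) / √m = -√m := by rw [zero_sub, neg_div, Real.div_sqrt]
  rw [incGamma_add_two_eq hm, incGamma_add_two_eq hm, h0, Pi.div_apply,
    mul_div_mul_left _ _ (by positivity)]
end
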